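/- Let A be a Köthe matrix satisfying condition (G1-1), and let C⁻¹ : ℂ^ℕ → ℂ^ℕ be the inverse Cesàro map (C⁻¹ y)_i = i·y_i − (i−1)·y_{i−1} (with y_0 := 0). Then the following are equivalent: (1) C⁻¹ maps λ₀(A) into itself and for every n there exist m and M > 0 with p_n(C⁻¹ y) ≤ M·p_m(y) for all y ∈ λ₀(A) (equivalently, 0 does not belong to the spectrum of the Cesàro operator on λ₀(A)); (2) for every n there exists m > n with sup_i i·a_n(i)/a_m(i) < ∞. -/

import Mathlib

open Filter Finset Topology

noncomputable section

/-- A Köthe matrix: entries are nonnegative, increasing in `n`, and for each column some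
entry is positive.  (Index `i : ℕ` corresponds to the index `i + 1` of the paper.) -/
def KotheMatrix (a : ℕ → ℕ → ℝ) : Prop :=
  (∀ n i, 0 ≤ a n i ∧ a n i ≤ a (n + 1) i) ∧ ∀ i, ∃ n, 0 < a n i

/-- Condition (G1-1): `0 < a_n(i+1) ≤ a_n(i)`. -/
def G11 (a : ℕ → ℕ → ℝ) : Prop :=
  ∀ n i, 0 < a n (i + 1) ∧ a n (i + 1) ≤ a n i

/-- Condition (G1-2). -/
def G12 (a : ℕ → ℕ → ℝ) : Prop :=
  ∀ n, ∃ m > n, ∃ C > 0, ∀ i, a n i ≤ C * a m i ^ 2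

/-- Membership in the Köthe echelon space of order zero `λ₀(A)`. -/
def inLambda0 (a : ℕ → ℕ → ℝ) (x : ℕ → ℂ) : Prop :=
  ∀ n, Tendsto (fun i => a n i * ‖x i‖) atTop (𝓝 0)

/-- The canonical seminorms `p_n(x) = sup_i a_n(i) |x_i|` of `λ₀(A)`. -/
def pnorm (a : ℕ → ℕ → ℝ) (n : ℕ) (x : ℕ → ℂ) : ℝ :=
  ⨆ i, a n i * ‖x i‖

/-- The discrete Cesàro operator, `(C x)_i = (x_1 + ⋯ + x_i) / i` (indices shifted by one). -/
def cesaro (x : ℕ → ℂ) : ℕ → ℂ :=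
  fun i => (∑ j ∈ Finset.range (i + 1), x j) / ((i : ℂ) + 1)

/-- The inverse Cesàro map `(C⁻¹ y)_i = i·y_i − (i−1)·y_{i−1}` (indices shifted by one;
at the first coordinate it is just `y_1`). -/
def icesaro (y : ℕ → ℂ) : ℕ → ℂ := fun i => ((i : ℂ) + 1) * y i - (i : ℂ) * y (i - 1)

theorem G11.pos {a : ℕ → ℕ → ℝ} (hG : G11 a) (n i : ℕ) : 0 < a n i :=
  (hG n i).1.trans_le (hG n i).2

theorem KotheMatrix.mono {a : ℕ → ℕ → ℝ} (hK : KotheMatrix a) (i : ℕ) :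
    Monotone fun n => a n i :=
  monotone_nat_of_le_succ fun n => (hK.1 n i).2

theorem inLambda0.le_pnorm {a : ℕ → ℕ → ℝ} {x : ℕ → ℂ} (hx : inLambda0 a x) (n i : ℕ) :
    a n i * ‖x i‖ ≤ pnorm a n x :=
  le_ciSup (hx n).bddAbove_range i

theorem inLambda0_single (a : ℕ → ℕ → ℝ) (k : ℕ) : inLambda0 a (Pi.single k 1) := by
  intro n
  refine tendsto_const_nhds.congr' ?_
  filter_upwards [eventually_gt_atTop k] with i hi
  simp [Pi.single_eq_of_ne hi.ne']

theorem pnorm_single_le {a : ℕ → ℕ → ℝ} (hG : G11 a) (n k : ℕ) :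
    pnorm a n (Pi.single k 1) ≤ a n k := by
  refine ciSup_le fun i => ?_
  rcases eq_or_ne i k with rfl | h
  · simp
  · simpa [Pi.single_eq_of_ne h] using (hG.pos n k).le

theorem icesaro_single_self (k : ℕ) : icesaro (Pi.single k 1) k = (k : ℂ) + 1 := by
  cases k <;> simp [icesaro]

/-- A weighted coordinate of `icesaro y` is controlled by two neighbouring weighted coordinates
of `y`. -/
theorem mul_norm_icesaro_le {a : ℕ → ℕ → ℝ} (hG : G11 a) {n m : ℕ} {M : ℝ} (hM : 0 ≤ M)
    (h : ∀ i : ℕ, ((i : ℝ) + 1) * a n i ≤ M * a m i) (y : ℕ → ℂ) (i : ℕ) :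
    a n i * ‖icesaro y i‖ ≤ M * (a m i * ‖y i‖ + a m (i - 1) * ‖y (i - 1)‖) := by
  have hn := (hG.pos n i).le
  have hnorm : ‖icesaro y i‖ ≤ ((i : ℝ) + 1) * ‖y i‖ + i * ‖y (i - 1)‖ := by
    refine (norm_sub_le _ _).trans_eq ?_
    have hi : ‖(i : ℂ) + 1‖ = (i : ℝ) + 1 := by exact_mod_cast Complex.norm_natCast (i + 1)
    rw [norm_mul, norm_mul, hi, Complex.norm_natCast]
  have hprev : i * a n i ≤ M * a m (i - 1) := by
    cases i with
    | zero => simpa using mul_nonneg hM (hG.pos m 0).le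
    | succ j =>
      refine le_trans ?_ (h j)
      push_cast
      exact mul_le_mul_of_nonneg_left (hG n j).2 (by positivity)
  calc a n i * ‖icesaro y i‖
      ≤ a n i * (((i : ℝ) + 1) * ‖y i‖ + i * ‖y (i - 1)‖) := by gcongr
    _ = (((i : ℝ) + 1) * a n i) * ‖y i‖ + (i * a n i) * ‖y (i - 1)‖ := by ring
    _ ≤ (M * a m i) * ‖y i‖ + (M * a m (i - 1)) * ‖y (i - 1)‖ :=
      add_le_add (mul_le_mul_of_nonneg_right (h i) (norm_nonneg _))
        (mul_le_mul_of_nonneg_right hprev (norm_nonneg _))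
    _ = M * (a m i * ‖y i‖ + a m (i - 1) * ‖y (i - 1)‖) := by ring

/-- For a Köthe matrix satisfying (G1-1), continuity of the inverse Cesàro map on `λ₀(A)`
(equivalently `0 ∉ σ(C; λ₀(A))`) is equivalent to `sup_i i·a_n(i)/a_m(i) < ∞`. -/
theorem stmt5 (a : ℕ → ℕ → ℝ) (hK : KotheMatrix a) (hG : G11 a) :
    ((∀ y : ℕ → ℂ, inLambda0 a y → inLambda0 a (icesaro y)) ∧
        ∀ n : ℕ, ∃ m : ℕ, ∃ M > (0 : ℝ),
          ∀ y : ℕ → ℂ, inLambda0 a y → pnorm a n (icesaro y) ≤ M * pnorm a m y) ↔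
      (∀ n : ℕ, ∃ m > n, ∃ M : ℝ, ∀ i : ℕ, ((i : ℝ) + 1) * a n i / a m i ≤ M) := by
  constructor
  · rintro ⟨hmaps, hcont⟩ n
    obtain ⟨m, M, hM, h⟩ := hcont n
    refine ⟨max m (n + 1), lt_max_of_lt_right n.lt_succ_self, M, fun i => ?_⟩
    rw [div_le_iff₀ (hG.pos _ i)]
    have hi : ‖(i : ℂ) + 1‖ = (i : ℝ) + 1 := by exact_mod_cast Complex.norm_natCast (i + 1)
    have hs := inLambda0_single a i
    calc ((i : ℝ) + 1) * a n i = a n i * ‖icesaro (Pi.single i 1) i‖ := by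
          rw [icesaro_single_self, hi, mul_comm]
      _ ≤ pnorm a n (icesaro (Pi.single i 1)) := (hmaps _ hs).le_pnorm n i
      _ ≤ M * pnorm a m (Pi.single i 1) := h _ hs
      _ ≤ M * a m i := by
          gcongr
          exact pnorm_single_le hG m i
      _ ≤ M * a (max m (n + 1)) i := by
          gcongr
          exact hK.mono i (le_max_left _ _)
  · intro H
    have key : ∀ n, ∃ m, ∃ M > (0 : ℝ), ∀ y i, a n i * ‖icesaro y i‖ ≤
        M * (a m i * ‖y i‖ + a m (i - 1) * ‖y (i - 1)‖) := by
      intro n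
      obtain ⟨m, -, M, h⟩ := H n
      have hM : 0 < M := by
        refine lt_of_lt_of_le ?_ (h 0)
        have := hG.pos n 0
        have := hG.pos m 0
        positivity
      exact ⟨m, M, hM, mul_norm_icesaro_le hG hM.le
        fun i => (div_le_iff₀ (hG.pos m i)).1 (h i)⟩
    refine ⟨fun y hy n => ?_, fun n => ?_⟩
    · obtain ⟨m, M, -, h⟩ := key n
      refine squeeze_zero (fun i => mul_nonneg (hG.pos n i).le (norm_nonneg _)) (h y) ?_
      simpa using ((hy m).add ((hy m).comp (tendsto_sub_atTop_nat 1))).const_mul M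
    · obtain ⟨m, M, hM, h⟩ := key n
      refine ⟨m, M * 2, by positivity, fun y hy => ciSup_le fun i => (h y i).trans ?_⟩
      rw [mul_assoc, two_mul]
      gcongr
      · exact hy.le_pnorm m i
      · exact hy.le_pnorm m (i - 1)
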